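/- In the Algorithm-1 iteration of a definite multi-context system with m bridge rules in total (m = Σ_i |br_i|), the iteration stabilizes after at most m steps: kb^{m+1}_i = kb^m_i for every i, and consequently S^{m+1} = S^m. -/

import Mathlib

/-- A bridge rule of a definite MCS: a head literal and a finite positive body. -/
structure Rule (n : ℕ) (α : Type*) where
  head : α
  body : Finset (Fin n × α)
deriving DecidableEq

/-- A definite multi-context system: for each context, a monotone semantic
operator and a finite set of bridge rules. -/
structure MCS (n : ℕ) (α : Type*) [DecidableEq α] where
  ACC : Fin n → Finset α → Finset α
  mono : ∀ i, Monotone (ACC i)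
  br : Fin n → Finset (Rule n α)

variable {n : ℕ} {α : Type*} [DecidableEq α]

/-- A bridge rule is satisfied in a belief state `S` iff every body literal holds. -/
def Satisfied (r : Rule n α) (S : Fin n → Finset α) : Prop :=
  ∀ cp ∈ r.body, cp.2 ∈ S cp.1

instance (r : Rule n α) (S : Fin n → Finset α) : Decidable (Satisfied r S) := by
  unfold Satisfied; infer_instance

/-- The knowledge base induced at context `i` by belief state `S`:
the heads of the bridge rules of context `i` satisfied in `S`. -/
def kbOf (M : MCS n α) (S : Fin n → Finset α) (i : Fin n) : Finset α :=
  ((M.br i).filter (fun r => Satisfied r S)).image Rule.head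

/-- A belief state is an equilibrium iff each belief set is the result of
applying the semantic operator to the induced knowledge base. -/
def IsEquilibrium (M : MCS n α) (S : Fin n → Finset α) : Prop :=
  ∀ i, S i = M.ACC i (kbOf M S i)

/-- Algorithm-1 iteration: the knowledge-base tuples `kb^k`. -/
def kbIter (M : MCS n α) : ℕ → Fin n → Finset α
  | 0 => fun _ => ∅
  | k + 1 => fun i =>
      kbIter M k i ∪
        ((M.br i).filter (fun r =>
            Satisfied r (fun j => M.ACC j (kbIter M k j)))).image Rule.head

/-- Algorithm-1 iteration: the belief states `S^k`. -/
def SIter (M : MCS n α) (k : ℕ) (i : Fin n) : Finset α :=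
  M.ACC i (kbIter M k i)

theorem kbIter_subset_succ (M : MCS n α) (k : ℕ) (i : Fin n) :
    kbIter M k i ⊆ kbIter M (k + 1) i :=
  Finset.subset_union_left

theorem kbIter_subset_image_head (M : MCS n α) (k : ℕ) (i : Fin n) :
    kbIter M k i ⊆ (M.br i).image Rule.head := by
  induction k with
  | zero => exact Finset.empty_subset _
  | succ k ih =>
    exact Finset.union_subset ih (Finset.image_subset_image (Finset.filter_subset _ _))

theorem sum_card_kbIter_le (M : MCS n α) (k : ℕ) :
    ∑ i, (kbIter M k i).card ≤ ∑ i, (M.br i).card :=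
  Finset.sum_le_sum fun i _ =>
    (Finset.card_le_card (kbIter_subset_image_head M k i)).trans Finset.card_image_le

/-- The next knowledge base tuple depends only on the current one, so a fixed tuple persists. -/
theorem kbIter_succ_succ_eq (M : MCS n α) {k : ℕ} (h : kbIter M (k + 1) = kbIter M k) :
    kbIter M (k + 2) = kbIter M (k + 1) := by
  funext i
  change kbIter M (k + 1) i ∪ ((M.br i).filter (fun r =>
      Satisfied r (fun j => M.ACC j (kbIter M (k + 1) j)))).image Rule.head = _
  simp only [h]
  exact congrFun h i

theorem sum_card_kbIter_lt_succ (M : MCS n α) {k : ℕ} (h : kbIter M (k + 1) ≠ kbIter M k) :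
    ∑ i, (kbIter M k i).card < ∑ i, (kbIter M (k + 1) i).card := by
  obtain ⟨i, hi⟩ := Function.ne_iff.mp h
  exact Finset.sum_lt_sum (fun j _ => Finset.card_le_card (kbIter_subset_succ M k j))
    ⟨i, Finset.mem_univ i,
      Finset.card_lt_card ((kbIter_subset_succ M k i).ssubset_of_ne hi.symm)⟩

/-- As long as the iteration has not stabilized, every step adds at least one literal. -/
theorem lt_sum_card_kbIter_succ (M : MCS n α) {k : ℕ} (h : kbIter M (k + 1) ≠ kbIter M k) :
    k < ∑ i, (kbIter M (k + 1) i).card := by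
  induction k with
  | zero => exact (Nat.zero_le _).trans_lt (sum_card_kbIter_lt_succ M h)
  | succ k ih =>
    exact (Nat.succ_le_of_lt (ih (mt (kbIter_succ_succ_eq M) h))).trans_lt
      (sum_card_kbIter_lt_succ M h)

/-- the Algorithm-1 iteration stabilizes after at most `m` steps,
where `m` is the total number of bridge rules of `M`. -/
theorem algorithm1_stabilizes (M : MCS n α) (m : ℕ)
    (hm : m = ∑ i, (M.br i).card) :
    (∀ i, kbIter M (m + 1) i = kbIter M m i) ∧ SIter M (m + 1) = SIter M m := by
  have h : kbIter M (m + 1) = kbIter M m := by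
    by_contra hne
    have hlt := lt_sum_card_kbIter_succ M hne
    have hle := sum_card_kbIter_le M (m + 1)
    omega
  exact ⟨congrFun h, funext fun i => congrArg (M.ACC i) (congrFun h i)⟩
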